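/- In H(d,1,n), for every 1 ≤ k ≤ d−1, the element s₂ z^k s₂ belongs to the R₀-span of the products λ₁λ₂ with λ₁ ∈ Λ₁ and λ₂ ∈ Λ''₂, where Λ''₂ = {1, s₂, s₂z, s₂z², …, s₂z^{k−1}, s₂zs₂, (s₂zs₂)², …, (s₂zs₂)^k}. -/

import Mathlib

noncomputable section

open scoped Pointwise

/-- The base ring `R₀ = ℤ[a, b₁, …, b_{d-1}]`, with `a` the variable of index `0`
and `b_i` the variable of index `i` for `1 ≤ i ≤ d-1`. -/
abbrev R0 (d : ℕ) : Type := MvPolynomial (Fin d) ℤ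

/-- The variable `a ∈ R₀`. -/
def aV (d : ℕ) : R0 d := if h : 0 < d then MvPolynomial.X (⟨0, h⟩ : Fin d) else 0

/-- The variable `b_i ∈ R₀` for `1 ≤ i ≤ d-1`. -/
def bV (d i : ℕ) : R0 d := if h : i < d then MvPolynomial.X (⟨i, h⟩ : Fin d) else 0

/-- Generators of the classical presentation of the Hecke algebra `H(d,1,n)`:
`z` and `s_j` for `2 ≤ j ≤ n`. -/
inductive HGen (n : ℕ) : Type
  | z : HGen n
  | s : (j : ℕ) → 2 ≤ j → j ≤ n → HGen n

open FreeAlgebra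

/-- The free `R₀`-algebra on the generators. -/
abbrev FA (d n : ℕ) : Type := FreeAlgebra (R0 d) (HGen n)

/-- The defining relations of the Hecke algebra `H(d,1,n)`. -/
inductive HRel (d n : ℕ) : FA d n → FA d n → Prop
  | zszs (h : 2 ≤ n) :
      HRel d n (ι (R0 d) HGen.z * ι (R0 d) (HGen.s 2 le_rfl h) *
                  ι (R0 d) HGen.z * ι (R0 d) (HGen.s 2 le_rfl h))
               (ι (R0 d) (HGen.s 2 le_rfl h) * ι (R0 d) HGen.z *
                  ι (R0 d) (HGen.s 2 le_rfl h) * ι (R0 d) HGen.z)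
  | zs (j : ℕ) (h2 : 2 ≤ j) (h3 : 3 ≤ j) (hn : j ≤ n) :
      HRel d n (ι (R0 d) HGen.z * ι (R0 d) (HGen.s j h2 hn))
               (ι (R0 d) (HGen.s j h2 hn) * ι (R0 d) HGen.z)
  | braid (i : ℕ) (h2 : 2 ≤ i) (h2' : 2 ≤ i + 1) (hn' : i ≤ n) (hn : i + 1 ≤ n) :
      HRel d n (ι (R0 d) (HGen.s i h2 hn') * ι (R0 d) (HGen.s (i + 1) h2' hn) *
                  ι (R0 d) (HGen.s i h2 hn'))
               (ι (R0 d) (HGen.s (i + 1) h2' hn) * ι (R0 d) (HGen.s i h2 hn') *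
                  ι (R0 d) (HGen.s (i + 1) h2' hn))
  | comm (i j : ℕ) (h2i : 2 ≤ i) (hni : i ≤ n) (h2j : 2 ≤ j) (hnj : j ≤ n)
      (hij : i + 1 < j ∨ j + 1 < i) :
      HRel d n (ι (R0 d) (HGen.s i h2i hni) * ι (R0 d) (HGen.s j h2j hnj))
               (ι (R0 d) (HGen.s j h2j hnj) * ι (R0 d) (HGen.s i h2i hni))
  | zd :
      HRel d n (ι (R0 d) HGen.z ^ d)
               ((∑ i ∈ Finset.Icc 1 (d - 1),
                  algebraMap (R0 d) (FA d n) (bV d i) * ι (R0 d) HGen.z ^ (d - i)) + 1)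
  | sq (j : ℕ) (h2 : 2 ≤ j) (hn : j ≤ n) :
      HRel d n (ι (R0 d) (HGen.s j h2 hn) * ι (R0 d) (HGen.s j h2 hn))
               (algebraMap (R0 d) (FA d n) (aV d) * ι (R0 d) (HGen.s j h2 hn) + 1)

/-- The Hecke algebra `H(d,1,n)`. -/
abbrev Hecke (d n : ℕ) : Type := RingQuot (HRel d n)

/-- The generator `z` of `H(d,1,n)`. -/
def zH (d n : ℕ) : Hecke d n :=
  RingQuot.mkAlgHom (R0 d) (HRel d n) (ι (R0 d) HGen.z)

/-- The generator `s_j` of `H(d,1,n)` (junk value `1` when `j` is out of range). -/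
def sH (d n : ℕ) (j : ℕ) : Hecke d n :=
  if h : 2 ≤ j ∧ j ≤ n then RingQuot.mkAlgHom (R0 d) (HRel d n) (ι (R0 d) (HGen.s j h.1 h.2))
  else 1

/-- Decreasing-index product `s_m s_{m-1} ⋯ s_{i'}` (empty when `m < i'`). -/
def sDescH (d n m i' : ℕ) : Hecke d n :=
  (((List.range' i' (m + 1 - i')).reverse).map (sH d n)).prod

/-- Increasing-index product `s_{i'} s_{i'+1} ⋯ s_m` (empty when `m < i'`). -/
def sAscH (d n i' m : ℕ) : Hecke d n :=
  ((List.range' i' (m + 1 - i')).map (sH d n)).prod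

/-- `Λ₁ = {z^k : 0 ≤ k ≤ d-1}` in `H(d,1,n)`. -/
def Lam1 (d n : ℕ) : Set (Hecke d n) := {x | ∃ k < d, x = zH d n ^ k}

/-- `Λ_m = {1} ∪ {s_m ⋯ s_{i'} : 2 ≤ i' ≤ m} ∪ {s_m ⋯ s₂ z^k : 1 ≤ k ≤ d-1}
∪ {s_m ⋯ s₂ z^k s₂ s₃ ⋯ s_{i'} : 1 ≤ k ≤ d-1, 2 ≤ i' ≤ m}` in `H(d,1,n)`. -/
def LamG (d n m : ℕ) : Set (Hecke d n) :=
  {1} ∪ {x | ∃ i', 2 ≤ i' ∧ i' ≤ m ∧ x = sDescH d n m i'} ∪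
    {x | ∃ k, 1 ≤ k ∧ k < d ∧ x = sDescH d n m 2 * zH d n ^ k} ∪
    {x | ∃ k, 1 ≤ k ∧ k < d ∧ ∃ i', 2 ≤ i' ∧ i' ≤ m ∧
      x = sDescH d n m 2 * zH d n ^ k * sAscH d n 2 i'}


/-- `Λ''₂ = {1, s₂, s₂z, …, s₂z^{k-1}, s₂zs₂, (s₂zs₂)², …, (s₂zs₂)^k}`. -/
def Lam2'' (d n k : ℕ) : Set (Hecke d n) :=
  {1} ∪ {x | ∃ m < k, x = sH d n 2 * zH d n ^ m} ∪
    {x | ∃ m, 1 ≤ m ∧ m ≤ k ∧ x = (sH d n 2 * zH d n * sH d n 2) ^ m}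

theorem aux_zd (d n : ℕ) : zH d n ^ d =
    (∑ i ∈ Finset.Icc 1 (d - 1), bV d i • zH d n ^ (d - i)) + 1 := by
  have h := RingQuot.mkAlgHom_rel (R0 d) (HRel.zd (d := d) (n := n))
  simp only [map_pow, map_add, map_sum, map_mul, map_one, AlgHom.commutes] at h
  simp only [zH, Algebra.smul_def]
  exact h

theorem aux_sq (d n : ℕ) (hn : 2 ≤ n) :
    sH d n 2 * sH d n 2 = aV d • sH d n 2 + 1 := by
  have h := RingQuot.mkAlgHom_rel (R0 d) (HRel.sq (d := d) (n := n) 2 le_rfl hn)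
  simp only [map_add, map_mul, map_one, AlgHom.commutes] at h
  simp only [sH, Algebra.smul_def, le_refl, hn, and_self, dite_true]
  exact h

theorem aux_comm (d n : ℕ) (hn : 2 ≤ n) :
    Commute (zH d n) (sH d n 2 * zH d n * sH d n 2) := by
  have h := RingQuot.mkAlgHom_rel (R0 d) (HRel.zszs (d := d) (n := n) hn)
  simp only [map_mul] at h
  simp only [Commute, SemiconjBy, zH, sH, le_refl, hn, and_self, dite_true]
  simpa only [mul_assoc] using h

theorem aux_zpow (d n : ℕ) (hd : 2 ≤ d) (i : ℕ) :
    zH d n ^ i ∈ Submodule.span (R0 d) (Lam1 d n) := by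
  induction i using Nat.strong_induction_on with
  | _ i ih =>
    by_cases h : i < d
    · exact Submodule.subset_span ⟨i, h, rfl⟩
    · have e : zH d n ^ i = zH d n ^ (i - d) * zH d n ^ d := by
        rw [← pow_add]; congr 1; omega
      rw [e, aux_zd, mul_add, mul_one, Finset.mul_sum]
      refine Submodule.add_mem _ (Submodule.sum_mem _ fun j hj => ?_) (ih _ (by omega))
      rw [Finset.mem_Icc] at hj
      rw [mul_smul_comm, ← pow_add]
      exact Submodule.smul_mem _ _ (ih _ (by omega))

theorem aux_mem (d n : ℕ) (hd : 2 ≤ d) (k i : ℕ) (x : Hecke d n) (hx : x ∈ Lam2'' d n k) :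
    zH d n ^ i * x ∈ Submodule.span (R0 d) (Lam1 d n * Lam2'' d n k) := by
  rw [← Submodule.span_mul_span]
  exact Submodule.mul_mem_mul (aux_zpow d n hd i) (Submodule.subset_span hx)

theorem aux_szt (d n : ℕ) (hn : 2 ≤ n) (m : ℕ) :
    sH d n 2 * zH d n ^ m * (sH d n 2 * zH d n * sH d n 2) =
      aV d • (zH d n ^ m * (sH d n 2 * zH d n * sH d n 2)) +
        zH d n * (sH d n 2 * zH d n ^ m) := by
  have hc := ((aux_comm d n hn).pow_left m).eq
  rw [mul_assoc, hc]
  have : sH d n 2 * (sH d n 2 * zH d n * sH d n 2 * zH d n ^ m)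
      = (sH d n 2 * sH d n 2) * (zH d n * sH d n 2 * zH d n ^ m) := by
    simp only [mul_assoc]
  rw [this, aux_sq d n hn, add_mul, one_mul, smul_mul_assoc]
  simp only [mul_assoc]

theorem aux_rec (d n : ℕ) (hn : 2 ≤ n) (k : ℕ) :
    sH d n 2 * zH d n ^ (k + 1) * sH d n 2 =
      (sH d n 2 * zH d n ^ k * sH d n 2) * (sH d n 2 * zH d n * sH d n 2) +
        (-aV d) • (sH d n 2 * zH d n ^ k * (sH d n 2 * zH d n * sH d n 2)) := by
  have : (sH d n 2 * zH d n ^ k * sH d n 2) * (sH d n 2 * zH d n * sH d n 2) =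
      sH d n 2 * zH d n ^ k * ((sH d n 2 * sH d n 2) * (zH d n * sH d n 2)) := by
    simp only [mul_assoc]
  rw [this, aux_sq d n hn, add_mul, one_mul, smul_mul_assoc, mul_add, mul_smul_comm, pow_succ]
  simp only [mul_assoc]
  rw [add_right_comm, ← add_smul, add_neg_cancel, zero_smul, zero_add]

/-- For `1 ≤ k ≤ d-1`, `s₂ z^k s₂` lies in the `R₀`-span of `Λ₁Λ''₂`. -/
theorem s2zks2_mem_span (d n : ℕ) (hd : 2 ≤ d) (hn : 2 ≤ n)
    (k : ℕ) (hk1 : 1 ≤ k) (hk : k ≤ d - 1) :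
    sH d n 2 * zH d n ^ k * sH d n 2 ∈
      Submodule.span (R0 d) (Lam1 d n * Lam2'' d n k) := by
  clear hk
  induction k, hk1 using Nat.le_induction with
  | base =>
    have := aux_mem d n hd 1 0 (sH d n 2 * zH d n * sH d n 2)
      (Or.inr ⟨1, le_rfl, le_rfl, by rw [pow_one]⟩)
    simpa using this
  | succ k hk1 ih =>
    have key : ∀ i m, m ≤ k → zH d n ^ i *
        (sH d n 2 * zH d n ^ m * (sH d n 2 * zH d n * sH d n 2)) ∈
        Submodule.span (R0 d) (Lam1 d n * Lam2'' d n (k + 1)) := by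
      intro i m hm
      rw [aux_szt d n hn, mul_add, mul_smul_comm, ← mul_assoc, ← pow_add,
        ← mul_assoc (zH d n ^ i) (zH d n), ← pow_succ]
      refine Submodule.add_mem _ (Submodule.smul_mem _ _ (aux_mem d n hd _ _ _ ?_))
        (aux_mem d n hd _ _ _ ?_)
      · exact Or.inr ⟨1, le_rfl, by omega, by rw [pow_one]⟩
      · exact Or.inl (Or.inr ⟨m, by omega, rfl⟩)
    rw [aux_rec d n hn]
    have key0 := key 0 k le_rfl
    rw [pow_zero, one_mul] at key0
    refine Submodule.add_mem _ ?_ (Submodule.smul_mem _ _ key0)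
    revert ih
    generalize sH d n 2 * zH d n ^ k * sH d n 2 = y
    intro ih
    induction ih using Submodule.span_induction with
    | zero => simp
    | add x y _ _ hx hy => rw [add_mul]; exact Submodule.add_mem _ hx hy
    | smul a x _ hx => rw [smul_mul_assoc]; exact Submodule.smul_mem _ _ hx
    | mem x hx =>
      obtain ⟨_, ⟨i, -, rfl⟩, w, hw, rfl⟩ := hx
      change zH d n ^ i * w * _ ∈ _
      rw [mul_assoc]
      rcases hw with (hw | ⟨m, hm, rfl⟩) | ⟨m, hm1, hm, rfl⟩
      · rw [Set.mem_singleton_iff] at hw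
        subst hw
        rw [one_mul]
        exact aux_mem d n hd _ _ _ (Or.inr ⟨1, le_rfl, by omega, by rw [pow_one]⟩)
      · exact key i m (by omega)
      · rw [← pow_succ]
        exact aux_mem d n hd _ _ _ (Or.inr ⟨m + 1, by omega, by omega, rfl⟩)
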